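/- Let a ∈ ℝ, β, η, ν > 0, and let h : ℝ → ℝ be bounded and measurable. Suppose the worst-case tail problem with parameters (a, β, η, ν) is feasible, and let Z* be its optimal value. Then exactly one of the following holds: (1) there exists a feasible f* whose restriction to [a, ∞) lies in 𝒫ℒ₃⁺[a, ∞) and which attains Z*; or (2) no feasible f attains Z*, and there exists a sequence of feasible functions f⁽ᵏ⁾ whose restrictions to [a, ∞) lie in 𝒫ℒ₃⁺[a, ∞) with ∫_a^∞ h(x) f⁽ᵏ⁾(x) dx → Z*, such that, writing the last (third) line segment of f⁽ᵏ⁾ as x ↦ c₃⁽ᵏ⁾ + d₃⁽ᵏ⁾x on [y₂⁽ᵏ⁾, y₃⁽ᵏ⁾], one has y₃⁽ᵏ⁾ ↗ ∞ and d₃⁽ᵏ⁾ ↗ 0 with d₃⁽ᵏ⁾ ≤ 0 (i.e. d₃⁽ᵏ⁾ increases to 0 from below) as k → ∞. -/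

import Mathlib

open MeasureTheory Set Filter Topology

/-- The right derivative of `f` at `x`: the derivative within `(x, ∞)`. -/
noncomputable def rightDeriv (f : ℝ → ℝ) (x : ℝ) : ℝ := derivWithin f (Set.Ioi x) x

/-- The right derivative of `f` exists at `x`. -/
def HasRightDerivAt (f : ℝ → ℝ) (x : ℝ) : Prop := ∃ d : ℝ, HasDerivWithinAt f d (Set.Ioi x) x

/-- `f` is feasible for the worst-case tail problem with parameters `(a, β, η, ν)`. -/
def Feasible (a β η ν : ℝ) (f : ℝ → ℝ) : Prop :=
  IntegrableOn f (Set.Ioi a) ∧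
  (∫ x in Set.Ioi a, f x) = β ∧
  f a = η ∧
  ContinuousWithinAt f (Set.Ici a) a ∧
  HasRightDerivAt f a ∧
  -ν ≤ rightDeriv f a ∧
  ConvexOn ℝ (Set.Ici a) f ∧
  (∀ x, a ≤ x → 0 ≤ f x)

/-- The restriction of `f` to `[a, ∞)` is nonnegative, continuous, piecewise linear
with at most `m` segments, and vanishes beyond the last kink (the class `𝒫ℒ_m⁺[a, ∞)`). -/
def PLplus (a : ℝ) (m : ℕ) (f : ℝ → ℝ) : Prop :=
  (∀ x, a ≤ x → 0 ≤ f x) ∧ ContinuousOn f (Set.Ici a) ∧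
  ∃ y : ℕ → ℝ, y 0 = a ∧ (∀ j, j < m → y j ≤ y (j + 1)) ∧
    (∀ j, j < m → ∃ c d : ℝ, ∀ x ∈ Set.Icc (y j) (y (j + 1)), f x = c + d * x) ∧
    (∀ x, y m < x → f x = 0)


lemma wt_weak_sep {E : Type*} [NormedAddCommGroup E] [NormedSpace ℝ E] [FiniteDimensional ℝ E]
    {s : Set E} (hs : Convex ℝ s) (hne : s.Nonempty) {x : E} (hx : x ∉ s) :
    ∃ f : StrongDual ℝ E, f ≠ 0 ∧ ∀ y ∈ s, f y ≤ f x := by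
  by_cases hi : (interior s).Nonempty
  · exact geometric_hahn_banach_of_nonempty_interior_point hs (fun h => hx (interior_subset h)) hi
  · rw [hs.interior_nonempty_iff_affineSpan_eq_top] at hi
    obtain ⟨z, hz⟩ := hne
    have hdir : (affineSpan ℝ s).direction < ⊤ := by
      rw [lt_top_iff_ne_top]
      intro h
      exact hi ((AffineSubspace.direction_eq_top_iff_of_nonempty
        ⟨z, subset_affineSpan ℝ s hz⟩).1 h)
    obtain ⟨g, hg0, hg⟩ := Submodule.exists_le_ker_of_lt_top _ hdir
    have hconst : ∀ y ∈ s, g y = g z := by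
      intro y hy
      have := hg (AffineSubspace.vsub_mem_direction (subset_affineSpan ℝ s hy)
        (subset_affineSpan ℝ s hz))
      simpa [sub_eq_zero] using this
    have hg0' : LinearMap.toContinuousLinearMap g ≠ 0 := by
      simpa using hg0
    rcases le_total (g z) (g x) with hle | hle
    · refine ⟨LinearMap.toContinuousLinearMap g, hg0', fun y hy => ?_⟩
      simpa [hconst y hy] using hle
    · refine ⟨-LinearMap.toContinuousLinearMap g, by simpa using hg0, fun y hy => ?_⟩
      simpa [hconst y hy] using hle

/-- The mean of a probability measure carried by a convex set in finite dimension lies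
in the set (no closedness needed). -/
lemma wt_mean_mem {Ω : Type*} [MeasurableSpace Ω] (μ : Measure Ω) [IsProbabilityMeasure μ] :
    ∀ (n : ℕ) (E : Type) [NormedAddCommGroup E] [NormedSpace ℝ E] [FiniteDimensional ℝ E]
      (_ : Module.finrank ℝ E = n) (s : Set E) (_ : Convex ℝ s) (g : Ω → E)
      (_ : Integrable g μ) (_ : ∀ᵐ ω ∂μ, g ω ∈ s) (_ : ∫ ω, g ω ∂μ = 0), (0 : E) ∈ s := by
  intro n
  induction n using Nat.strong_induction_on with
  | _ n ih =>
    intro E _ _ _ hn s hs g hg hgs hg0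
    by_contra h0
    have hne : s.Nonempty := by
      obtain ⟨ω, hω⟩ := hgs.exists
      exact ⟨_, hω⟩
    obtain ⟨φ, hφ0, hφ⟩ := wt_weak_sep hs hne h0
    have hint : ∫ ω, φ (g ω) ∂μ = 0 := by
      rw [φ.integral_comp_comm hg, hg0, map_zero]
    have hz : ∀ᵐ ω ∂μ, φ (g ω) = 0 := by
      have h1 : ∫ ω, -φ (g ω) ∂μ = 0 := by rw [integral_neg, hint, neg_zero]
      have h2 : 0 ≤ᵐ[μ] fun ω => -φ (g ω) := by
        filter_upwards [hgs] with ω hω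
        have := hφ _ hω
        simp only [map_zero] at this
        simpa using this
      have h3 := (integral_eq_zero_iff_of_nonneg_ae h2 (φ.integrable_comp hg).neg).1 h1
      filter_upwards [h3] with ω hω
      simpa using hω
    let K := LinearMap.ker φ.toLinearMap
    have hK : Module.finrank ℝ K < n := by
      rw [← hn]
      apply Submodule.finrank_lt
      intro htop
      apply hφ0
      ext v
      have : v ∈ K := by rw [show K = ⊤ from htop]; trivial
      simpa [K] using this
    obtain ⟨π, hπ⟩ := K.exists_isCompl
    let P : E →L[ℝ] K := LinearMap.toContinuousLinearMap (Submodule.projectionOnto K π hπ)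
    have hP : ∀ v ∈ K, ((P v : K) : E) = v := by
      intro v hv
      have := Submodule.projectionOnto_apply_left hπ ⟨v, hv⟩
      simpa [P] using congrArg Subtype.val this
    have := ih _ hK K rfl (K.subtype ⁻¹' s) (hs.linear_preimage K.subtype) (fun ω => P (g ω))
      (P.integrable_comp hg) (by
        filter_upwards [hgs, hz] with ω h1 h2
        have : g ω ∈ K := by simpa [K] using h2
        simpa [hP _ this] using h1) (by rw [P.integral_comp_comm hg, hg0, map_zero])
    exact h0 (by simpa using this)

lemma wt_reduce {ι : Type} [DecidableEq ι] (φ₁ φ₂ H : ι → ℝ) : ∀ (n : ℕ) (s : Finset ι)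
    (_ : s.card = n + 3) (w : ι → ℝ) (_ : ∀ i ∈ s, 0 ≤ w i),
    ∃ s' : Finset ι, s' ⊆ s ∧ s'.card = 3 ∧ ∃ w' : ι → ℝ, (∀ i ∈ s', 0 ≤ w' i) ∧
      ∑ i ∈ s', w' i = ∑ i ∈ s, w i ∧ ∑ i ∈ s', w' i * φ₁ i = ∑ i ∈ s, w i * φ₁ i ∧
      ∑ i ∈ s', w' i * φ₂ i = ∑ i ∈ s, w i * φ₂ i ∧
      ∑ i ∈ s, w i * H i ≤ ∑ i ∈ s', w' i * H i := by
  intro n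
  induction n with
  | zero => intro s hs w hw; exact ⟨s, subset_rfl, by simpa using hs, w, hw, rfl, rfl, rfl, le_rfl⟩
  | succ n ih =>
    intro s hs w hw
    have hv : ∃ v : ι → ℝ, (∃ i ∈ s, v i ≠ 0) ∧ ∑ i ∈ s, v i = 0 ∧ ∑ i ∈ s, v i * φ₁ i = 0 ∧
        ∑ i ∈ s, v i * φ₂ i = 0 := by
      have hnl : ¬ LinearIndependent ℝ (fun i : s => (![1, φ₁ i, φ₂ i] : Fin 3 → ℝ)) := by
        intro hl
        have := hl.fintype_card_le_finrank
        simp at this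
        omega
      rw [Fintype.not_linearIndependent_iff] at hnl
      obtain ⟨g, hg, i, hi⟩ := hnl
      refine ⟨fun j => if h : j ∈ s then g ⟨j, h⟩ else 0, ⟨i, i.2, by simpa using hi⟩, ?_, ?_, ?_⟩
      all_goals rw [← Finset.sum_coe_sort]
      · simpa using congrFun hg 0
      · simpa using congrFun hg 1
      · simpa using congrFun hg 2
    have hv' : ∃ v : ι → ℝ, (∃ i ∈ s, v i < 0) ∧ ∑ i ∈ s, v i = 0 ∧ ∑ i ∈ s, v i * φ₁ i = 0 ∧
        ∑ i ∈ s, v i * φ₂ i = 0 ∧ 0 ≤ ∑ i ∈ s, v i * H i := by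
      obtain ⟨v, hne, h0, h1, h2⟩ := hv
      have key : ∀ u : ι → ℝ, (∃ i ∈ s, u i ≠ 0) → ∑ i ∈ s, u i = 0 → ∃ i ∈ s, u i < 0 := by
        intro u ⟨i, his, hi⟩ hu
        by_contra hcon
        push Not at hcon
        exact hi ((Finset.sum_eq_zero_iff_of_nonneg hcon).1 hu i his)
      rcases le_total 0 (∑ i ∈ s, v i * H i) with hH | hH
      · exact ⟨v, key v hne h0, h0, h1, h2, hH⟩
      · refine ⟨fun i => - v i, key _ (by simpa using hne) (by simp [h0]), by simp [h0],
          by simp [h1], by simp [h2], by simpa using hH⟩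
    obtain ⟨v, ⟨i₁, hi₁, hvi₁⟩, h0, h1, h2, hH⟩ := hv'
    obtain ⟨j, hj, hmin⟩ := Finset.exists_min_image (s.filter (fun i => v i < 0))
      (fun i => w i / (- v i)) ⟨i₁, by simp [hi₁, hvi₁]⟩
    simp only [Finset.mem_filter] at hj hmin
    obtain ⟨hjs, hvj⟩ := hj
    set θ := w j / (- v j) with hθ
    have hθ0 : 0 ≤ θ := div_nonneg (hw j hjs) (by linarith)
    let w₁ : ι → ℝ := fun i => w i + θ * v i
    have hw₁ : ∀ i ∈ s, 0 ≤ w₁ i := by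
      intro i hi
      by_cases hvi : v i < 0
      · have := hmin i ⟨hi, hvi⟩
        rw [le_div_iff₀ (by linarith)] at this
        simp only [w₁]; linarith
      · have := mul_nonneg hθ0 (not_lt.1 hvi)
        have := hw i hi
        simp only [w₁]; linarith
    have hw₁j : w₁ j = 0 := by
      simp only [w₁, hθ]
      have : v j ≠ 0 := hvj.ne
      field_simp
      ring
    have herase : ∀ ψ : ι → ℝ, ∑ i ∈ s.erase j, w₁ i * ψ i
        = ∑ i ∈ s, w i * ψ i + θ * ∑ i ∈ s, v i * ψ i := by
      intro ψ
      have h3 := Finset.add_sum_erase s (fun i => w₁ i * ψ i) hjs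
      simp only [hw₁j, zero_mul, zero_add] at h3
      rw [h3, Finset.mul_sum, ← Finset.sum_add_distrib]
      exact Finset.sum_congr rfl fun i _ => by simp only [w₁]; ring
    obtain ⟨s', hs', hc, w', hw', e0, e1, e2, e3⟩ := ih (s.erase j)
      (by rw [Finset.card_erase_of_mem hjs, hs]; rfl) w₁
      (fun i hi => hw₁ i (Finset.mem_of_mem_erase hi))
    refine ⟨s', hs'.trans (Finset.erase_subset _ _), hc, w', hw', ?_, ?_, ?_, ?_⟩
    · rw [e0]; simpa [h0] using herase (fun _ => 1)
    · rw [e1]; simpa [h1] using herase φ₁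
    · rw [e2]; simpa [h2] using herase φ₂
    · rw [herase H] at e3
      have := mul_nonneg hθ0 hH
      linarith

lemma wt_atoms {Ω : Type*} [MeasurableSpace Ω] (ρ : Measure Ω) [IsProbabilityMeasure ρ]
    (a : ℝ) (T : Ω → ℝ) (haT : ∀ ω, a ≤ T ω) (φ₁ φ₂ H : ℝ → ℝ)
    (h1 : Integrable (fun ω => φ₁ (T ω)) ρ) (h2 : Integrable (fun ω => φ₂ (T ω)) ρ)
    (h3 : Integrable (fun ω => H (T ω)) ρ) :
    ∃ p t : Fin 3 → ℝ, (∀ i, 0 ≤ p i) ∧ Monotone t ∧ (∀ i, a ≤ t i) ∧ ∑ i, p i = 1 ∧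
      ∑ i, p i * φ₁ (t i) = ∫ ω, φ₁ (T ω) ∂ρ ∧ ∑ i, p i * φ₂ (t i) = ∫ ω, φ₂ (T ω) ∂ρ ∧
      ∫ ω, H (T ω) ∂ρ ≤ ∑ i, p i * H (t i) := by
  classical
  let F : ℝ → ℝ × ℝ × ℝ := fun t => (φ₁ t, φ₂ t, H t)
  let K : Set (ℝ × ℝ × ℝ) := F '' Ici a
  have hFi : Integrable (fun ω => F (T ω)) ρ := h1.prodMk (h2.prodMk h3)
  set m := ∫ ω, F (T ω) ∂ρ with hm
  have hm1 : m.1 = ∫ ω, φ₁ (T ω) ∂ρ := by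
    have := (ContinuousLinearMap.fst ℝ ℝ (ℝ × ℝ)).integral_comp_comm hFi
    exact this.symm
  have hm2 : m.2.1 = ∫ ω, φ₂ (T ω) ∂ρ := by
    have := ((ContinuousLinearMap.fst ℝ ℝ ℝ).comp
      (ContinuousLinearMap.snd ℝ ℝ (ℝ × ℝ))).integral_comp_comm hFi
    exact this.symm
  have hm3 : m.2.2 = ∫ ω, H (T ω) ∂ρ := by
    have := ((ContinuousLinearMap.snd ℝ ℝ ℝ).comp
      (ContinuousLinearMap.snd ℝ ℝ (ℝ × ℝ))).integral_comp_comm hFi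
    exact this.symm
  have hmem : m ∈ convexHull ℝ K := by
    have := wt_mean_mem ρ _ (ℝ × ℝ × ℝ) rfl ((fun z => m + z) ⁻¹' convexHull ℝ K)
      ((convex_convexHull ℝ K).translate_preimage_right m) (fun ω => F (T ω) - m)
      (hFi.sub (integrable_const _))
      (Eventually.of_forall fun ω => by
        simpa using subset_convexHull ℝ K ⟨T ω, haT ω, rfl⟩)
      (by rw [integral_sub hFi (integrable_const _)]; simp [hm])
    simpa using this
  rw [convexHull_eq] at hmem
  obtain ⟨ι, s, w, z, hw, hw1, hz, hc⟩ := hmem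
  rw [Finset.centerMass_eq_of_sum_1 _ _ hw1] at hc
  have hτ : ∀ i, ∃ τ : ℝ, a ≤ τ ∧ (i ∈ s → F τ = z i) := by
    intro i
    by_cases hi : i ∈ s
    · obtain ⟨τ, h, h'⟩ := hz i hi
      exact ⟨τ, h, fun _ => h'⟩
    · exact ⟨a, le_rfl, fun h => absurd h hi⟩
  choose τ hτa hτ using hτ
  let σ : ι ⊕ Fin 3 → ℝ := Sum.elim τ (fun _ => a)
  let W : ι ⊕ Fin 3 → ℝ := Sum.elim w (fun _ => 0)
  have hσ : ∀ i, a ≤ σ i := by rintro (i | i) <;> simp [σ, hτa]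
  have hsum : ∀ ψ : ℝ → ℝ, ∑ i ∈ s.disjSum Finset.univ, W i * ψ (σ i) = ∑ i ∈ s, w i * ψ (τ i) := by
    intro ψ; simp [Finset.sum_disjSum, W, σ]
  obtain ⟨s', -, hc3, w', hw', e0, e1, e2, e3⟩ := wt_reduce (fun i => φ₁ (σ i)) (fun i => φ₂ (σ i))
    (fun i => H (σ i)) s.card (s.disjSum Finset.univ) (by simp) W (by
      rintro (i | i) hi
      · simpa [W] using hw i (by simpa using hi)
      · simp [W])
  have q0 : ∑ i ∈ s', w' i = 1 := by
    rw [e0, ← hw1]; simp [Finset.sum_disjSum, W]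
  have hF : ∑ i ∈ s, w i • F (τ i) = m := by
    rw [← hc]; exact Finset.sum_congr rfl fun i hi => by rw [hτ i hi]
  rw [hsum φ₁, show ∑ i ∈ s, w i * φ₁ (τ i) = m.1 by rw [← hF]; simp [Prod.fst_sum, F], hm1] at e1
  rw [hsum φ₂, show ∑ i ∈ s, w i * φ₂ (τ i) = m.2.1 by
    rw [← hF]; simp [Prod.fst_sum, Prod.snd_sum, F], hm2] at e2
  rw [hsum H, show ∑ i ∈ s, w i * H (τ i) = m.2.2 by
    rw [← hF]; simp [Prod.snd_sum, F], hm3] at e3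
  let e : Fin 3 ≃ s' := (Finset.equivFinOfCardEq hc3).symm
  let π : Equiv.Perm (Fin 3) := Tuple.sort (fun i => σ (e i))
  have hre : ∀ ψ : ι ⊕ Fin 3 → ℝ, ∑ i : Fin 3, ψ (e (π i)) = ∑ i ∈ s', ψ i := by
    intro ψ
    rw [← Finset.sum_coe_sort s', ← Equiv.sum_comp (π.trans e)]
    rfl
  refine ⟨fun i => w' (e (π i)), fun i => σ (e (π i)), fun i => hw' _ (e (π i)).2,
    Tuple.monotone_sort (fun i => σ (e i)), fun i => hσ _, ?_, ?_, ?_, ?_⟩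
  · rw [hre w', q0]
  · rw [hre (fun i => w' i * φ₁ (σ i)), e1]
  · rw [hre (fun i => w' i * φ₂ (σ i)), e2]
  · rw [hre (fun i => w' i * H (σ i))]; exact e3

/-- The tent function with kink at `t`. -/
noncomputable def wtTent (t x : ℝ) : ℝ := max (t - x) 0

lemma wtTent_eq_indicator (a t : ℝ) : Set.EqOn (wtTent t) ((Ioc a t).indicator fun x => t - x)
    (Ioi a) := by
  intro x hx
  by_cases h : x ≤ t
  · rw [indicator_of_mem (show x ∈ Ioc a t from ⟨hx, h⟩), wtTent, max_eq_left (by linarith)]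
  · rw [indicator_of_notMem (by simp [h]), wtTent, max_eq_right (by linarith)]

lemma wtTent_integrable (a t : ℝ) : IntegrableOn (wtTent t) (Ioi a) := by
  rw [integrableOn_congr_fun (wtTent_eq_indicator a t) measurableSet_Ioi]
  apply Integrable.integrableOn
  rw [integrable_indicator_iff measurableSet_Ioc]
  exact (by fun_prop : Continuous fun x : ℝ => t - x).integrableOn_Ioc

lemma wtTent_integral {a t : ℝ} (h : a ≤ t) : ∫ x in Ioi a, wtTent t x = (t - a) ^ 2 / 2 := by
  rw [setIntegral_congr_fun measurableSet_Ioi (wtTent_eq_indicator a t),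
    setIntegral_indicator measurableSet_Ioc,
    inter_eq_right.2 (fun x hx => hx.1), ← intervalIntegral.integral_of_le h]
  rw [intervalIntegral.integral_sub (by simp) (by simp)]
  simp
  ring

lemma wtTent_nonneg (t x : ℝ) : 0 ≤ wtTent t x := le_max_right _ _

lemma wtTent_continuous (t : ℝ) : Continuous (wtTent t) := by
  unfold wtTent; fun_prop

lemma wtTent_convex (t : ℝ) : ConvexOn ℝ univ (wtTent t) := by
  have h1 : ConvexOn ℝ univ (fun x : ℝ => t - x) :=
    ((convexOn_const t convex_univ).sub (concaveOn_id convex_univ))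
  exact h1.sup (convexOn_const 0 convex_univ)

lemma wtTent_mul_integrable (a t : ℝ) (h : ℝ → ℝ) (hmeas : Measurable h) (M : ℝ)
    (hM : ∀ x, |h x| ≤ M) : IntegrableOn (fun x => h x * wtTent t x) (Ioi a) :=
  (wtTent_integrable a t).bdd_mul (c := M) hmeas.aestronglyMeasurable (Eventually.of_forall hM)

/-- The objective value of a tent. -/
noncomputable def wtH (a : ℝ) (h : ℝ → ℝ) (t : ℝ) : ℝ := ∫ x in Ioi a, h x * wtTent t x

lemma wtH_diff (a : ℝ) (h : ℝ → ℝ) (hmeas : Measurable h) (M : ℝ)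
    (hM : ∀ x, |h x| ≤ M) {t t' : ℝ} (ht : a ≤ t) (htt : t ≤ t') :
    |wtH a h t' - wtH a h t| ≤ M * ((t' - a) ^ 2 / 2 - (t - a) ^ 2 / 2) := by
  unfold wtH
  rw [← integral_sub (wtTent_mul_integrable a t' h hmeas M hM)
    (wtTent_mul_integrable a t h hmeas M hM), ← wtTent_integral ht, ← wtTent_integral (ht.trans htt),
    ← integral_sub (wtTent_integrable a t') (wtTent_integrable a t), ← integral_const_mul]
  refine norm_integral_le_of_norm_le
    (f := fun x => h x * wtTent t' x - h x * wtTent t x) (g := fun x => M * (wtTent t' x - wtTent t x))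
    (((wtTent_integrable a t').sub (wtTent_integrable a t)).const_mul M) ?_
  refine Eventually.of_forall fun x => ?_
  have h0 : wtTent t x ≤ wtTent t' x := max_le_max (by linarith) le_rfl
  rw [← mul_sub, norm_mul, Real.norm_eq_abs, Real.norm_eq_abs, abs_of_nonneg (sub_nonneg.2 h0)]
  exact mul_le_mul_of_nonneg_right (hM x) (sub_nonneg.2 h0)

lemma wtH_continuousOn (a : ℝ) (h : ℝ → ℝ) (hmeas : Measurable h) (M : ℝ)
    (hM : ∀ x, |h x| ≤ M) : ContinuousOn (wtH a h) (Ici a) := by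
  intro t ht
  have hb : ∀ t' ∈ Ici a, |wtH a h t' - wtH a h t| ≤ M * |(t' - a) ^ 2 / 2 - (t - a) ^ 2 / 2| := by
    intro t' ht'
    have hM0 : 0 ≤ M := (abs_nonneg _).trans (hM 0)
    rcases le_total t t' with hle | hle
    · exact (wtH_diff a h hmeas M hM ht hle).trans (mul_le_mul_of_nonneg_left (le_abs_self _) hM0)
    · rw [abs_sub_comm, abs_sub_comm ((t' - a) ^ 2 / 2)]
      exact (wtH_diff a h hmeas M hM ht' hle).trans (mul_le_mul_of_nonneg_left (le_abs_self _) hM0)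
  rw [ContinuousWithinAt, tendsto_iff_norm_sub_tendsto_zero]
  refine squeeze_zero' (Eventually.of_forall fun _ => norm_nonneg _)
    (eventually_nhdsWithin_of_forall hb) ?_
  have hc : Continuous fun t' : ℝ => M * |(t' - a) ^ 2 / 2 - (t - a) ^ 2 / 2| := by fun_prop
  have := (hc.tendsto t).mono_left (nhdsWithin_le_nhds (s := Ici a))
  simpa using this

/-- Mixture of three tents. -/
noncomputable def wtMix (p t : Fin 3 → ℝ) (x : ℝ) : ℝ := ∑ i, p i * wtTent (t i) x

/-- Admissible three-atom parameters. -/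
def wtAdm (a β η ν : ℝ) (p t : Fin 3 → ℝ) : Prop :=
  (∀ i, 0 ≤ p i) ∧ Monotone t ∧ (∀ i, a ≤ t i) ∧ ∑ i, p i = ν ∧
    ∑ i, p i * (t i - a) = η ∧ ∑ i, p i * ((t i - a) ^ 2 / 2) = β

lemma wtMix_obj (a : ℝ) (h : ℝ → ℝ) (hmeas : Measurable h) (M : ℝ)
    (hM : ∀ x, |h x| ≤ M) (p t : Fin 3 → ℝ) :
    ∫ x in Ioi a, h x * wtMix p t x = ∑ i, p i * wtH a h (t i) := by
  unfold wtMix wtH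
  simp_rw [← integral_const_mul]
  rw [← integral_finsetSum _ (fun i _ => (wtTent_mul_integrable a (t i) h hmeas M hM).const_mul (p i))]
  congr 1
  ext x
  rw [Finset.mul_sum]
  exact Finset.sum_congr rfl fun i _ => by ring

lemma wtMix_nonneg {p : Fin 3 → ℝ} (hp : ∀ i, 0 ≤ p i) (t : Fin 3 → ℝ) (x : ℝ) :
    0 ≤ wtMix p t x := Finset.sum_nonneg fun i _ => mul_nonneg (hp i) (wtTent_nonneg _ _)

lemma wtMix_continuous (p t : Fin 3 → ℝ) : Continuous (wtMix p t) :=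
  continuous_finsetSum _ fun i _ => continuous_const.mul (wtTent_continuous (t i))

lemma wtTent_deriv {a t : ℝ} (h : a ≤ t) :
    ∃ d : ℝ, -1 ≤ d ∧ HasDerivWithinAt (wtTent t) d (Ioi a) a := by
  rcases h.eq_or_lt with rfl | h
  · refine ⟨0, by norm_num, ?_⟩
    refine (hasDerivWithinAt_const a (Ioi a) (0 : ℝ)).congr (fun x hx => ?_) (by simp [wtTent])
    exact max_eq_right (by simpa using (show a < x from hx).le)
  · refine ⟨-1, le_rfl, ?_⟩
    have h1 : HasDerivAt (fun x : ℝ => t - x) (-1) a := by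
      simpa using (hasDerivAt_id a).const_sub t
    refine (h1.congr_of_eventuallyEq ?_).hasDerivWithinAt
    filter_upwards [gt_mem_nhds h] with x hx
    exact max_eq_left (by linarith)

lemma wtMix_feasible {a β η ν : ℝ} {p t : Fin 3 → ℝ} (hA : wtAdm a β η ν p t) :
    Feasible a β η ν (wtMix p t) := by
  obtain ⟨hp, -, ha, h0, h1, h2⟩ := hA
  choose d hd1 hd using fun i => wtTent_deriv (ha i)
  have hder : HasDerivWithinAt (wtMix p t) (∑ i, p i * d i) (Ioi a) a := by
    have := HasDerivWithinAt.sum (u := Finset.univ) (fun i _ => (hd i).const_mul (p i))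
    have he : wtMix p t = ∑ i, fun y => p i * wtTent (t i) y := by
      ext x; simp [wtMix]
    rw [he]; exact this
  refine ⟨?_, ?_, ?_, (wtMix_continuous p t).continuousWithinAt, ⟨_, hder⟩, ?_, ?_,
    fun x _ => wtMix_nonneg hp t x⟩
  · exact integrable_finsetSum _ fun i _ => (wtTent_integrable a (t i)).const_mul (p i)
  · unfold wtMix
    rw [integral_finsetSum _ fun i _ => (wtTent_integrable a (t i)).const_mul (p i), ← h2]
    exact Finset.sum_congr rfl fun i _ => by rw [integral_const_mul, wtTent_integral (ha i)]
  · rw [← h1]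
    exact Finset.sum_congr rfl fun i _ => by
      rw [wtTent, max_eq_left (sub_nonneg.2 (ha i))]
  · rw [rightDeriv, hder.derivWithin (uniqueDiffWithinAt_Ioi a), ← h0, ← Finset.sum_neg_distrib]
    exact Finset.sum_le_sum fun i _ => by nlinarith [hp i, hd1 i]
  · have : ConvexOn ℝ univ (wtMix p t) := by
      have : wtMix p t = fun x => p 0 * wtTent (t 0) x + p 1 * wtTent (t 1) x + p 2 * wtTent (t 2) x := by
        ext x; simp [wtMix, Fin.sum_univ_three]
      rw [this]
      exact (((wtTent_convex (t 0)).smul (hp 0)).add ((wtTent_convex (t 1)).smul (hp 1))).add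
        ((wtTent_convex (t 2)).smul (hp 2))
    exact this.subset (subset_univ _) (convex_Ici a)

lemma wtMix_last {p t : Fin 3 → ℝ} (ht : Monotone t) :
    (∀ x ∈ Icc (t 1) (t 2), wtMix p t x = p 2 * t 2 + (-p 2) * x) ∧
    (∀ x, t 2 < x → wtMix p t x = 0) := by
  have h01 : t 0 ≤ t 1 := ht (by decide)
  have h12 : t 1 ≤ t 2 := ht (by decide)
  constructor
  · rintro x ⟨hx1, hx2⟩
    simp only [wtMix, Fin.sum_univ_three, wtTent]
    rw [max_eq_right (by linarith), max_eq_right (by linarith), max_eq_left (by linarith)]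
    ring
  · intro x hx
    simp only [wtMix, Fin.sum_univ_three, wtTent]
    rw [max_eq_right (by linarith), max_eq_right (by linarith), max_eq_right (by linarith)]
    ring

lemma wtMix_PL {a β η ν : ℝ} {p t : Fin 3 → ℝ} (hA : wtAdm a β η ν p t) :
    PLplus a 3 (wtMix p t) := by
  obtain ⟨hp, ht, ha, -⟩ := hA
  have h01 : t 0 ≤ t 1 := ht (by decide)
  have h12 : t 1 ≤ t 2 := ht (by decide)
  refine ⟨fun x _ => wtMix_nonneg hp t x, (wtMix_continuous p t).continuousOn,
    fun n => match n with | 0 => a | 1 => t 0 | 2 => t 1 | _ => t 2, rfl, ?_, ?_, ?_⟩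
  · intro j hj
    interval_cases j
    · exact ha 0
    · exact h01
    · exact h12
  · intro j hj
    interval_cases j
    · refine ⟨p 0 * t 0 + p 1 * t 1 + p 2 * t 2, -(p 0 + p 1 + p 2), fun x hx => ?_⟩
      have h1 : a ≤ x := hx.1
      have h2 : x ≤ t 0 := hx.2
      simp only [wtMix, Fin.sum_univ_three, wtTent]
      rw [max_eq_left (by linarith), max_eq_left (by linarith), max_eq_left (by linarith)]
      ring
    · refine ⟨p 1 * t 1 + p 2 * t 2, -(p 1 + p 2), fun x hx => ?_⟩
      have h1 : t 0 ≤ x := hx.1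
      have h2 : x ≤ t 1 := hx.2
      simp only [wtMix, Fin.sum_univ_three, wtTent]
      rw [max_eq_right (by linarith), max_eq_left (by linarith), max_eq_left (by linarith)]
      ring
    · exact ⟨_, _, (wtMix_last ht).1⟩
  · exact (wtMix_last ht).2

lemma wt_not_bdd_below {a b c : ℝ} (hc : 0 < c) (hab : a ≤ b) {f : ℝ → ℝ}
    (hf : IntegrableOn f (Ioi a)) (h : ∀ z, b < z → c ≤ f z) : False := by
  have h1 : IntegrableOn f (Ioi b) := hf.mono_set (Ioi_subset_Ioi hab)
  have h2 : IntegrableOn (fun _ => c) (Ioi b) := by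
    refine Integrable.mono' h1 aestronglyMeasurable_const ?_
    refine (ae_restrict_mem measurableSet_Ioi).mono fun z hz => ?_
    rw [Real.norm_eq_abs, abs_of_pos hc]
    exact h z hz
  rw [integrableOn_const_iff] at h2
  simp [hc.ne'] at h2

section
variable {a β η ν : ℝ} {f : ℝ → ℝ}

lemma wt_antitone (hF : Feasible a β η ν f) : AntitoneOn f (Ici a) := by
  obtain ⟨hi, -, -, -, -, -, hc, h0⟩ := hF
  intro x hx y hy hxy
  by_contra hlt
  push Not at hlt
  have hxy' : x < y := lt_of_le_of_ne hxy (by rintro rfl; exact lt_irrefl _ hlt)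
  refine wt_not_bdd_below (lt_of_le_of_lt (h0 x hx) hlt) hy hi (fun z hz => ?_)
  have := hc.slope_mono_adjacent hx (le_trans (mem_Ici.1 hy) hz.le : z ∈ Ici a) hxy' hz
  have h1 : 0 < (f y - f x) / (y - x) := div_pos (by linarith) (by linarith)
  have h2 : 0 < (f z - f y) / (z - y) := by linarith
  have h3 := (div_pos_iff_of_pos_right (sub_pos.2 hz)).1 h2
  linarith

lemma wt_tendsto (hF : Feasible a β η ν f) : Tendsto f atTop (𝓝 0) := by
  have hanti := wt_antitone hF
  obtain ⟨hi, -, -, -, -, -, hc, h0⟩ := hF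
  rw [tendsto_order]
  constructor
  · intro c hc0
    filter_upwards [eventually_ge_atTop a] with x hx
    exact hc0.trans_le (h0 x hx)
  · intro c hc0
    obtain ⟨z, hz, hfz⟩ : ∃ z, a < z ∧ f z < c := by
      by_contra hcon
      push Not at hcon
      exact wt_not_bdd_below hc0 le_rfl hi hcon
    filter_upwards [eventually_ge_atTop z] with x hx
    exact (hanti hz.le (hz.le.trans hx) hx).trans_lt hfz

/-- Minus the right derivative. -/
noncomputable def wtD (f : ℝ → ℝ) (y : ℝ) : ℝ := - derivWithin f (Ioi y) y

lemma wtD_measurable (f : ℝ → ℝ) : Measurable (wtD f) := (measurable_derivWithin_Ioi f).neg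

lemma wtD_antitone (hF : Feasible a β η ν f) : AntitoneOn (wtD f) (Ioi a) := by
  have := hF.2.2.2.2.2.2.1.monotoneOn_rightDeriv
  rw [interior_Ici] at this
  exact this.neg

lemma wtD_hasDeriv (hF : Feasible a β η ν f) {y : ℝ} (hy : a < y) :
    HasDerivWithinAt f (- wtD f y) (Ioi y) y := by
  rw [wtD, neg_neg]
  exact hF.2.2.2.2.2.2.1.hasDerivWithinAt_rightDeriv_of_mem_interior (by simpa using hy)

lemma wtD_slope (hF : Feasible a β η ν f) {y : ℝ} (hy : a < y) :
    wtD f y * (y - a) ≤ f a - f y := by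
  have hc := hF.2.2.2.2.2.2.1
  have hyi : y ∈ interior (Ici a) := by simpa using hy
  have h1 := hc.leftDeriv_le_rightDeriv_of_mem_interior hyi
  have h2 := hc.slope_le_leftDeriv_of_mem_interior (x := a) (y := y) (by simp) hyi hy
  have h3 := h2.trans h1
  rw [slope_def_field, div_le_iff₀ (sub_pos.2 hy)] at h3
  rw [wtD]; linarith

lemma wtD_nonneg (hF : Feasible a β η ν f) {y : ℝ} (hy : a < y) : 0 ≤ wtD f y := by
  have hc := hF.2.2.2.2.2.2.1
  have hyi : y ∈ interior (Ici a) := by simpa using hy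
  have h1 := hc.rightDeriv_le_slope_of_mem_interior hyi (y := y + 1)
    (by simp only [mem_Ici]; linarith) (by linarith)
  rw [slope_def_field] at h1
  have h2 := wt_antitone hF hy.le (show y + 1 ∈ Ici a by simp only [mem_Ici]; linarith) (by linarith)
  rw [wtD]
  simp at h1
  linarith

lemma wtD_le (hF : Feasible a β η ν f) {y : ℝ} (hy : a < y) : wtD f y ≤ ν := by
  obtain ⟨d, hd⟩ := hF.2.2.2.2.1
  have hd' := hF.2.2.2.2.2.1
  have hc := hF.2.2.2.2.2.2.1
  rw [rightDeriv] at hd'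
  have h1 := hc.rightDeriv_le_slope (x := a) (y := y) (by simp) hy.le hy hd.differentiableWithinAt
  rw [slope_def_field, le_div_iff₀ (sub_pos.2 hy)] at h1
  have h2 := wtD_slope hF hy
  have h3 : 0 < y - a := sub_pos.2 hy
  have h4 : wtD f y * (y - a) ≤ ν * (y - a) := by nlinarith
  exact le_of_mul_le_mul_right h4 h3

lemma wt_contOn (hF : Feasible a β η ν f) : ContinuousOn f (Ici a) := by
  have h1 := hF.2.2.2.2.2.2.1.continuousOn_interior
  rw [interior_Ici] at h1
  intro x hx
  rcases (mem_Ici.1 hx).eq_or_lt with rfl | hlt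
  · exact hF.2.2.2.1
  · exact (h1.continuousAt (Ioi_mem_nhds hlt)).continuousWithinAt

lemma wtD_integrableOn (hF : Feasible a β η ν f) {x : ℝ} (hx : a ≤ x) (b : ℝ) :
    IntegrableOn (wtD f) (Ioc x b) := by
  refine Integrable.mono' (g := fun _ => ν) (by simp) (wtD_measurable f).aestronglyMeasurable ?_
  refine (ae_restrict_mem measurableSet_Ioc).mono fun y hy => ?_
  have hay : a < y := lt_of_le_of_lt hx hy.1
  rw [Real.norm_eq_abs, abs_of_nonneg (wtD_nonneg hF hay)]
  exact wtD_le hF hay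

lemma wtD_interval (hF : Feasible a β η ν f) {x b : ℝ} (hx : a ≤ x) (hb : x ≤ b) :
    ∫ y in x..b, wtD f y = f x - f b := by
  have := intervalIntegral.integral_eq_sub_of_hasDeriv_right_of_le (f := f)
    (f' := fun y => - wtD f y) hb
    ((wt_contOn hF).mono fun y hy => hx.trans hy.1)
    (fun y hy => wtD_hasDeriv hF (lt_of_le_of_lt hx hy.1))
    ((intervalIntegrable_iff_integrableOn_Ioc_of_le hb).2 (wtD_integrableOn hF hx b)).neg
  rw [intervalIntegral.integral_neg] at this
  linarith

lemma wtD_lintegral (hF : Feasible a β η ν f) {x : ℝ} (hx : a ≤ x) :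
    ∫⁻ y in Ioi x, ENNReal.ofReal (wtD f y) = ENNReal.ofReal (f x) := by
  have hlim : Tendsto (fun b => ∫ y in x..b, wtD f y) atTop (𝓝 (f x)) := by
    have h1 : Tendsto (fun b => f x - f b) atTop (𝓝 (f x)) := by
      simpa using (wt_tendsto hF).const_sub (f x)
    refine h1.congr' ?_
    filter_upwards [eventually_ge_atTop x] with b hb
    rw [wtD_interval hF hx hb]
  have hint : IntegrableOn (wtD f) (Ioi x) := by
    refine integrableOn_Ioi_of_intervalIntegral_norm_tendsto (f x) x
      (fun b => wtD_integrableOn hF hx b) tendsto_id ?_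
    refine hlim.congr' ?_
    filter_upwards [eventually_ge_atTop x] with b hb
    simp only [id_eq, intervalIntegral.integral_of_le hb]
    refine setIntegral_congr_fun measurableSet_Ioc fun y hy => ?_
    rw [Real.norm_eq_abs, abs_of_nonneg (wtD_nonneg hF (lt_of_le_of_lt hx hy.1))]
  rw [← ofReal_integral_eq_lintegral_ofReal hint, tendsto_nhds_unique
    (intervalIntegral_tendsto_integral_Ioi x hint tendsto_id) hlim]
  exact (ae_restrict_mem measurableSet_Ioi).mono fun y hy => wtD_nonneg hF (lt_of_le_of_lt hx hy)

/-- Generalized inverse of `wtD f`. -/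
noncomputable def wtT (a : ℝ) (f : ℝ → ℝ) (u : ℝ) : ℝ :=
  max a (sSup (insert a {y | a < y ∧ u < wtD f y}))

lemma wtT_bdd (hF : Feasible a β η ν f) {u : ℝ} (hu : 0 < u) :
    BddAbove (insert a {y | a < y ∧ u < wtD f y}) := by
  refine BddAbove.insert a ⟨a + f a / u, ?_⟩
  rintro y ⟨hy, hD⟩
  have h1 := wtD_slope hF hy
  have h2 := hF.2.2.2.2.2.2.2 y hy.le
  have h3 : y - a ≤ f a / u := by
    rw [le_div_iff₀ hu]
    nlinarith
  linarith

lemma wtT_eq (hF : Feasible a β η ν f) {u : ℝ} (hu : 0 < u) :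
    wtT a f u = sSup (insert a {y | a < y ∧ u < wtD f y}) :=
  max_eq_right (le_csSup (wtT_bdd hF hu) (mem_insert _ _))

lemma wtT_antitone (hF : Feasible a β η ν f) : AntitoneOn (wtT a f) (Ioo 0 ν) := by
  intro u hu v hv huv
  rw [wtT_eq hF hu.1, wtT_eq hF hv.1]
  refine csSup_le_csSup (wtT_bdd hF hu.1) (insert_nonempty _ _) (insert_subset_insert ?_)
  rintro y ⟨h1, h2⟩
  exact ⟨h1, huv.trans_lt h2⟩

lemma wtT_volume (hF : Feasible a β η ν f) {u x : ℝ} (hu : 0 < u) (hx : a ≤ x) :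
    volume ({y | u < wtD f y} ∩ Ioi x) = ENNReal.ofReal (wtT a f u - x) := by
  apply le_antisymm
  · rw [← Real.volume_Ioc]
    apply measure_mono
    rintro y ⟨h1, h2⟩
    refine ⟨h2, ?_⟩
    rw [wtT_eq hF hu]
    exact le_csSup (wtT_bdd hF hu) (mem_insert_of_mem _ ⟨lt_of_le_of_lt hx h2, h1⟩)
  · rw [← Real.volume_Ioo]
    apply measure_mono
    rintro y ⟨h1, h2⟩
    refine ⟨?_, h1⟩
    rw [wtT_eq hF hu] at h2
    obtain ⟨z, hz, hyz⟩ := exists_lt_of_lt_csSup (insert_nonempty _ _) h2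
    have hay := lt_of_le_of_lt hx h1
    rcases hz with rfl | ⟨hz1, hz2⟩
    · exact absurd (hay.trans hyz) (lt_irrefl _)
    · exact lt_of_lt_of_le hz2 (wtD_antitone hF hay hz1 hyz.le)

lemma wt_repr (hF : Feasible a β η ν f) {x : ℝ} (hx : a ≤ x) :
    ∫⁻ u in Ioo 0 ν, ENNReal.ofReal (wtTent (wtT a f u) x) = ENNReal.ofReal (f x) := by
  rw [← wtD_lintegral hF hx]
  have h1 : ∀ y ∈ Ioi x, ENNReal.ofReal (wtD f y) =
      ∫⁻ u in Ioo 0 ν, {p : ℝ × ℝ | p.1 < wtD f p.2}.indicator (fun _ => 1) (u, y) := by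
    intro y hy
    have hay := lt_of_le_of_lt hx hy
    have h2 : (fun u => {p : ℝ × ℝ | p.1 < wtD f p.2}.indicator (fun _ => (1 : ENNReal)) (u, y))
        = (Iio (wtD f y)).indicator (fun _ => 1) := by
      ext u; simp [indicator]
    rw [h2, lintegral_indicator measurableSet_Iio, lintegral_const, one_mul,
      Measure.restrict_apply MeasurableSet.univ, univ_inter,
      Measure.restrict_apply measurableSet_Iio]
    have h3 : Iio (wtD f y) ∩ Ioo 0 ν = Ioo 0 (wtD f y) := by
      ext u
      simp only [mem_inter_iff, mem_Iio, mem_Ioo]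
      have := wtD_le hF hay
      constructor
      · rintro ⟨h1, h2, h3⟩; exact ⟨h2, h1⟩
      · rintro ⟨h1, h2⟩; exact ⟨h2, h1, h2.trans_le this⟩
    rw [h3, Real.volume_Ioo, sub_zero]
  have hms : MeasurableSet {p : ℝ × ℝ | p.1 < wtD f p.2} :=
    measurableSet_lt measurable_fst ((wtD_measurable f).comp measurable_snd)
  rw [setLIntegral_congr_fun measurableSet_Ioi h1, lintegral_lintegral_swap]
  · refine setLIntegral_congr_fun measurableSet_Ioo fun u hu => ?_
    have h2 : (fun y => {p : ℝ × ℝ | p.1 < wtD f p.2}.indicator (fun _ => (1 : ENNReal)) (u, y))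
        = {y | u < wtD f y}.indicator (fun _ => 1) := by
      ext y; simp [indicator]
    have hm : MeasurableSet {y | u < wtD f y} := measurableSet_lt measurable_const (wtD_measurable f)
    rw [h2, lintegral_indicator hm, lintegral_const, one_mul,
      Measure.restrict_apply MeasurableSet.univ, univ_inter,
      Measure.restrict_apply hm, wtT_volume hF hu.1 hx, wtTent]
    simp [ENNReal.ofReal_max]
  · refine Measurable.aemeasurable ?_
    exact (measurable_const.indicator hms).comp measurable_swap

end

lemma wt_improve {a β η ν : ℝ} {f : ℝ → ℝ} (hν : 0 < ν) (h : ℝ → ℝ) (hmeas : Measurable h) (M : ℝ)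
    (hM : ∀ x, |h x| ≤ M) (hF : Feasible a β η ν f) :
    ∃ p t : Fin 3 → ℝ, wtAdm a β η ν p t ∧
      ∫ x in Ioi a, h x * f x ≤ ∑ i, p i * wtH a h (t i) := by
  set lam : Measure ℝ := volume.restrict (Ioo 0 ν) with hlam
  set kap : Measure ℝ := volume.restrict (Ioi a) with hkap
  have hTm : AEMeasurable (wtT a f) lam :=
    aemeasurable_restrict_of_antitoneOn measurableSet_Ioo (wtT_antitone hF)
  have haT : ∀ u, a ≤ wtT a f u := fun u => le_max_left _ _
  have hfi : Integrable f kap := hF.1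
  have hf0 := hF.2.2.2.2.2.2.2
  have hGm : AEMeasurable (fun q : ℝ × ℝ => wtTent (wtT a f q.1) q.2) (lam.prod kap) := by
    unfold wtTent
    exact ((hTm.comp_fst).sub measurable_snd.aemeasurable).max aemeasurable_const
  have hGl : ∫⁻ q, ENNReal.ofReal (wtTent (wtT a f q.1) q.2) ∂(lam.prod kap) < ⊤ := by
    rw [lintegral_prod_symm _ hGm.ennreal_ofReal]
    have : ∫⁻ x, ∫⁻ u, ENNReal.ofReal (wtTent (wtT a f u) x) ∂lam ∂kap
        = ∫⁻ x, ENNReal.ofReal (f x) ∂kap :=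
      setLIntegral_congr_fun measurableSet_Ioi fun x hx => wt_repr hF (le_of_lt hx)
    rw [this]
    exact hfi.lintegral_lt_top
  have hG : Integrable (fun q : ℝ × ℝ => wtTent (wtT a f q.1) q.2) (lam.prod kap) := by
    refine ⟨hGm.aestronglyMeasurable, ?_⟩
    rw [hasFiniteIntegral_iff_ofReal (Eventually.of_forall fun q => wtTent_nonneg _ _)]
    exact hGl
  have hhG : Integrable (fun q : ℝ × ℝ => h q.2 * wtTent (wtT a f q.1) q.2) (lam.prod kap) :=
    hG.bdd_mul (c := M) (hmeas.comp measurable_snd).aestronglyMeasurable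
      (Eventually.of_forall fun q => hM q.2)
  have hTx : ∀ x, AEMeasurable (fun u => wtTent (wtT a f u) x) lam := by
    intro x; unfold wtTent
    exact (hTm.sub aemeasurable_const).max aemeasurable_const
  have hfx : ∀ x, a ≤ x → ∫ u, wtTent (wtT a f u) x ∂lam = f x := by
    intro x hx
    rw [integral_eq_lintegral_of_nonneg_ae (Eventually.of_forall fun u => wtTent_nonneg _ _)
      (hTx x).aestronglyMeasurable, wt_repr hF hx, ENNReal.toReal_ofReal (hf0 x hx)]
  have hTa : ∀ u, wtTent (wtT a f u) a = wtT a f u - a := fun u =>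
    max_eq_left (sub_nonneg.2 (haT u))
  -- first moment
  have hi1 : Integrable (fun u => wtT a f u - a) lam := by
    have : Integrable (fun u => wtTent (wtT a f u) a) lam := by
      refine ⟨(hTx a).aestronglyMeasurable, ?_⟩
      rw [hasFiniteIntegral_iff_ofReal (Eventually.of_forall fun q => wtTent_nonneg _ _),
        wt_repr hF le_rfl]
      exact ENNReal.ofReal_lt_top
    simpa only [hTa] using this
  have hm1 : ∫ u, (wtT a f u - a) ∂lam = η := by
    have := hfx a le_rfl
    simp only [hTa] at this
    rw [this, hF.2.2.1]
  -- second moment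
  have hsec : ∀ u, ∫ x, wtTent (wtT a f u) x ∂kap = (wtT a f u - a) ^ 2 / 2 :=
    fun u => wtTent_integral (haT u)
  have hi2 : Integrable (fun u => (wtT a f u - a) ^ 2 / 2) lam := by
    have := hG.integral_prod_left
    simpa only [hsec] using this
  have hm2 : ∫ u, (wtT a f u - a) ^ 2 / 2 ∂lam = β := by
    simp only [← hsec]
    rw [integral_integral_swap (f := fun u x => wtTent (wtT a f u) x) hG, ← hF.2.1]
    exact setIntegral_congr_fun measurableSet_Ioi fun x hx => hfx x (le_of_lt hx)
  -- objective
  have hi3 : Integrable (fun u => wtH a h (wtT a f u)) lam := hhG.integral_prod_left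
  have hm3 : ∫ u, wtH a h (wtT a f u) ∂lam = ∫ x in Ioi a, h x * f x := by
    unfold wtH
    rw [integral_integral_swap (f := fun u x => h x * wtTent (wtT a f u) x) hhG]
    refine setIntegral_congr_fun measurableSet_Ioi fun x hx => ?_
    rw [integral_const_mul, hfx x (le_of_lt hx)]
  -- normalise
  have hν0 : ENNReal.ofReal ν ≠ 0 := by simpa using hν
  set rho : Measure ℝ := (ENNReal.ofReal ν)⁻¹ • lam with hrho
  have hfin : (ENNReal.ofReal ν)⁻¹ ≠ ⊤ := ENNReal.inv_ne_top.2 hν0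
  haveI : IsProbabilityMeasure rho := by
    refine ⟨?_⟩
    rw [hrho, Measure.smul_apply, hlam, Measure.restrict_apply MeasurableSet.univ, univ_inter,
      Real.volume_Ioo, sub_zero, smul_eq_mul]
    exact ENNReal.inv_mul_cancel hν0 ENNReal.ofReal_ne_top
  have hrint : ∀ g : ℝ → ℝ, ν * ∫ u, g u ∂rho = ∫ u, g u ∂lam := by
    intro g
    rw [hrho, integral_smul_measure, ENNReal.toReal_inv, ENNReal.toReal_ofReal hν.le, smul_eq_mul,
      mul_inv_cancel_left₀ hν.ne']
  obtain ⟨p, t, hp, ht, hat, e0, e1, e2, e3⟩ := wt_atoms rho a (wtT a f) haT (fun t => t - a)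
    (fun t => (t - a) ^ 2 / 2) (wtH a h) (hi1.smul_measure hfin) (hi2.smul_measure hfin)
    (hi3.smul_measure hfin)
  refine ⟨fun i => ν * p i, t, ⟨fun i => mul_nonneg hν.le (hp i), ht, hat, ?_, ?_, ?_⟩, ?_⟩
  · rw [← Finset.mul_sum, e0, mul_one]
  · simp only [mul_assoc]
    rw [← Finset.mul_sum, e1, hrint, hm1]
  · simp only [mul_assoc]
    rw [← Finset.mul_sum, e2, hrint, hm2]
  · simp only [mul_assoc]
    rw [← Finset.mul_sum, ← hm3, ← hrint]
    exact mul_le_mul_of_nonneg_left e3 hν.le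

lemma wt_bound {a β η ν : ℝ} {f : ℝ → ℝ} (h : ℝ → ℝ) (M : ℝ)
    (hM : ∀ x, |h x| ≤ M) (hF : Feasible a β η ν f) : ∫ x in Ioi a, h x * f x ≤ M * β := by
  have h1 : ‖∫ x in Ioi a, h x * f x‖ ≤ ∫ x in Ioi a, M * f x := by
    refine norm_integral_le_of_norm_le (hF.1.const_mul M) ?_
    refine (ae_restrict_mem measurableSet_Ioi).mono fun x hx => ?_
    have hx0 := hF.2.2.2.2.2.2.2 x (le_of_lt hx)
    rw [norm_mul, Real.norm_eq_abs, Real.norm_eq_abs, abs_of_nonneg hx0]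
    exact mul_le_mul_of_nonneg_right (hM x) hx0
  rw [integral_const_mul, hF.2.1] at h1
  exact (le_abs_self _).trans h1

/-- Compactness: a sequence of admissible parameters whose last knots are bounded by `B`
subconverges to an admissible parameter. -/
lemma wt_compact {a β η ν : ℝ} (h : ℝ → ℝ) (hmeas : Measurable h) (M : ℝ)
    (hM : ∀ x, |h x| ≤ M) (B Z : ℝ) (p t : ℕ → Fin 3 → ℝ)
    (hA : ∀ k, wtAdm a β η ν (p k) (t k)) (hB : ∀ k, t k 2 ≤ B)
    (hZ : Tendsto (fun k => ∑ i, p k i * wtH a h (t k i)) atTop (𝓝 Z)) :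
    ∃ p' t' : Fin 3 → ℝ, wtAdm a β η ν p' t' ∧ ∑ i, p' i * wtH a h (t' i) = Z := by
  have hmem : ∀ k, (p k, t k) ∈ (Icc (fun _ => 0) (fun _ => ν) : Set (Fin 3 → ℝ)) ×ˢ
      (Icc (fun _ => a) (fun _ => B) : Set (Fin 3 → ℝ)) := by
    intro k
    obtain ⟨hp, ht, ha, h0, -⟩ := hA k
    refine ⟨⟨hp, fun i => ?_⟩, ⟨ha, fun i => (ht (Fin.le_last i)).trans (hB k)⟩⟩
    rw [← h0]
    exact Finset.single_le_sum (f := p k) (fun j _ => hp j) (Finset.mem_univ i)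
  obtain ⟨⟨p', t'⟩, -, φ, hφ, hlim⟩ := (isCompact_Icc.prod isCompact_Icc).tendsto_subseq hmem
  have hlp : ∀ i, Tendsto (fun k => p (φ k) i) atTop (𝓝 (p' i)) := fun i =>
    ((continuous_apply i).comp continuous_fst).continuousAt.tendsto.comp hlim
  have hlt : ∀ i, Tendsto (fun k => t (φ k) i) atTop (𝓝 (t' i)) := fun i =>
    ((continuous_apply i).comp continuous_snd).continuousAt.tendsto.comp hlim
  have hat : ∀ i, a ≤ t' i := fun i => ge_of_tendsto' (hlt i) fun k => (hA (φ k)).2.2.1 i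
  have huniq : ∀ (ψ : ℝ → ℝ) (c : ℝ), ContinuousOn ψ (Ici a) →
      Tendsto (fun k => ∑ i, p (φ k) i * ψ (t (φ k) i)) atTop (𝓝 c) →
      ∑ i, p' i * ψ (t' i) = c := by
    intro ψ c hψ hc
    refine tendsto_nhds_unique (tendsto_finsetSum _ fun i _ => (hlp i).mul ?_) hc
    refine (hψ (t' i) (hat i)).tendsto.comp (tendsto_nhdsWithin_iff.2 ⟨hlt i, ?_⟩)
    exact Eventually.of_forall fun k => (hA (φ k)).2.2.1 i
  refine ⟨p', t', ⟨fun i => ge_of_tendsto' (hlp i) fun k => (hA (φ k)).1 i, ?_, hat, ?_, ?_, ?_⟩, ?_⟩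
  · intro i j hij
    exact le_of_tendsto_of_tendsto' (hlt i) (hlt j) fun k => (hA (φ k)).2.1 hij
  · simpa using huniq (fun _ => 1) ν continuousOn_const (by
      simp only [mul_one, (hA _).2.2.2.1]; exact tendsto_const_nhds)
  · exact huniq (fun t => t - a) η (by fun_prop) (by
      simp only [(hA _).2.2.2.2.1]; exact tendsto_const_nhds)
  · exact huniq (fun t => (t - a) ^ 2 / 2) β (by fun_prop) (by
      simp only [(hA _).2.2.2.2.2]; exact tendsto_const_nhds)
  · exact huniq (wtH a h) Z (wtH_continuousOn a h hmeas M hM) (hZ.comp hφ.tendsto_atTop)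

/-- A nonpositive sequence tending to zero has a monotone subsequence. -/
lemma wt_mono_subseq (d : ℕ → ℝ) (hd : ∀ k, d k ≤ 0) (hl : Tendsto d atTop (𝓝 0)) :
    ∃ φ : ℕ → ℕ, StrictMono φ ∧ Monotone (d ∘ φ) := by
  obtain ⟨g, hg⟩ := exists_increasing_or_nonincreasing_subseq (· ≤ ·) d
  rcases hg with hg | hg
  · exact ⟨g, g.strictMono, monotone_nat_of_le_succ fun n => hg n (n + 1) (Nat.lt_succ_self n)⟩
  · exfalso
    have h1 : Tendsto (d ∘ g) atTop (𝓝 0) := hl.comp g.strictMono.tendsto_atTop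
    have h2 : ∀ n, 1 ≤ n → d (g n) ≤ d (g 1) := by
      intro n hn
      rcases hn.eq_or_lt with rfl | hn
      · exact le_rfl
      · exact (not_le.1 (hg 1 n hn)).le
    have h3 : d (g 1) < d (g 0) := not_le.1 (hg 0 1 one_pos)
    have h4 : (0 : ℝ) ≤ d (g 1) := le_of_tendsto h1 (by
      filter_upwards [eventually_ge_atTop 1] with n hn using h2 n hn)
    linarith [hd (g 0)]

/-- Theorem 1 (main theorem): either the optimal value is attained by a feasible
piecewise linear density with at most 3 segments, or it is approached by a sequence of
such densities whose last segment flattens out and escapes to infinity. -/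
theorem main_optimality_structure
    (a β η ν : ℝ) (hβ : 0 < β) (hη : 0 < η) (hν : 0 < ν)
    (h : ℝ → ℝ) (hmeas : Measurable h) (hbd : ∃ M, ∀ x, |h x| ≤ M)
    (Zstar : ℝ)
    (hZ : Zstar = sSup {z : ℝ | ∃ f : ℝ → ℝ, Feasible a β η ν f ∧
      z = ∫ x in Set.Ioi a, h x * f x})
    (hfeas : ∃ f : ℝ → ℝ, Feasible a β η ν f) :
    (∃ f : ℝ → ℝ, Feasible a β η ν f ∧ PLplus a 3 f ∧
      (∫ x in Set.Ioi a, h x * f x) = Zstar) ∨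
    ((¬ ∃ f : ℝ → ℝ, Feasible a β η ν f ∧ (∫ x in Set.Ioi a, h x * f x) = Zstar) ∧
      ∃ (f : ℕ → ℝ → ℝ) (y₂ y₃ c₃ d₃ : ℕ → ℝ),
        (∀ k, Feasible a β η ν (f k) ∧ PLplus a 3 (f k) ∧
          a ≤ y₂ k ∧ y₂ k ≤ y₃ k ∧
          (∀ x ∈ Set.Icc (y₂ k) (y₃ k), f k x = c₃ k + d₃ k * x) ∧
          (∀ x, y₃ k < x → f k x = 0)) ∧
        Tendsto (fun k => ∫ x in Set.Ioi a, h x * f k x) atTop (𝓝 Zstar) ∧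
        Monotone y₃ ∧ Tendsto y₃ atTop atTop ∧
        Monotone d₃ ∧ (∀ k, d₃ k ≤ 0) ∧ Tendsto d₃ atTop (𝓝 0)) := by
  obtain ⟨M, hM⟩ := hbd
  set S := {z : ℝ | ∃ f : ℝ → ℝ, Feasible a β η ν f ∧ z = ∫ x in Set.Ioi a, h x * f x} with hS
  have hbdd : BddAbove S := ⟨M * β, by
    rintro z ⟨f, hf, rfl⟩
    exact wt_bound h M hM hf⟩
  have hne : S.Nonempty := by
    obtain ⟨f, hf⟩ := hfeas
    exact ⟨_, f, hf, rfl⟩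
  have hle : ∀ f, Feasible a β η ν f → ∫ x in Set.Ioi a, h x * f x ≤ Zstar := by
    intro f hf
    rw [hZ]
    exact le_csSup hbdd ⟨f, hf, rfl⟩
  have hleA : ∀ p t, wtAdm a β η ν p t → ∑ i, p i * wtH a h (t i) ≤ Zstar := by
    intro p t hA
    rw [← wtMix_obj a h hmeas M hM]
    exact hle _ (wtMix_feasible hA)
  by_cases hatt : ∃ f : ℝ → ℝ, Feasible a β η ν f ∧ (∫ x in Set.Ioi a, h x * f x) = Zstar
  · left
    obtain ⟨f, hf, hfZ⟩ := hatt
    obtain ⟨p, t, hA, hv⟩ := wt_improve hν h hmeas M hM hf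
    refine ⟨wtMix p t, wtMix_feasible hA, wtMix_PL hA, ?_⟩
    rw [wtMix_obj a h hmeas M hM]
    exact le_antisymm (hleA p t hA) (hfZ ▸ hv)
  · right
    refine ⟨hatt, ?_⟩
    obtain ⟨z, -, hzlim, hzS⟩ := exists_seq_tendsto_sSup hne hbdd
    rw [← hZ] at hzlim
    choose f hf hfz using hzS
    choose p t hA hv using fun k => wt_improve hν h hmeas M hM (hf k)
    have hlim : Tendsto (fun k => ∑ i, p k i * wtH a h (t k i)) atTop (𝓝 Zstar) :=
      tendsto_of_tendsto_of_tendsto_of_le_of_le hzlim tendsto_const_nhds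
        (fun k => by simpa only [hfz k] using hv k) (fun k => hleA _ _ (hA k))
    -- the last knot escapes to infinity
    have hesc : Tendsto (fun k => t k 2) atTop atTop := by
      rw [tendsto_atTop]
      intro B
      by_contra hcon
      rw [not_eventually] at hcon
      obtain ⟨φ, hφ, hφB⟩ := extraction_of_frequently_atTop hcon
      obtain ⟨p', t', hA', hval⟩ := wt_compact h hmeas M hM B Zstar (fun k => p (φ k))
        (fun k => t (φ k)) (fun k => hA _) (fun k => (not_le.1 (hφB k)).le)
        (hlim.comp hφ.tendsto_atTop)
      refine hatt ⟨wtMix p' t', wtMix_feasible hA', ?_⟩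
      rw [wtMix_obj a h hmeas M hM]
      exact hval
    -- the last slope flattens out
    have hflat : Tendsto (fun k => - p k 2) atTop (𝓝 0) := by
      have h1 : Tendsto (fun k => η / (t k 2 - a)) atTop (𝓝 0) :=
        tendsto_const_nhds.div_atTop (tendsto_atTop_add_const_right _ (-a) hesc)
      have h2 : Tendsto (fun k => p k 2) atTop (𝓝 0) := by
        refine squeeze_zero' (Eventually.of_forall fun k => (hA k).1 2) ?_ h1
        filter_upwards [hesc.eventually_gt_atTop a] with k hk
        rw [le_div_iff₀ (sub_pos.2 hk), ← (hA k).2.2.2.2.1]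
        exact Finset.single_le_sum (f := fun i => p k i * (t k i - a))
          (fun j _ => mul_nonneg ((hA k).1 j) (sub_nonneg.2 ((hA k).2.2.1 j))) (Finset.mem_univ 2)
      simpa using h2.neg
    obtain ⟨φ, hφ, hφm⟩ := wt_mono_subseq _ (fun k => neg_nonpos.2 ((hA k).1 2)) hflat
    obtain ⟨χ, hχ, hχm⟩ := strictMono_subseq_of_tendsto_atTop (hesc.comp hφ.tendsto_atTop)
    have hsub : Tendsto (fun k => φ (χ k)) atTop atTop :=
      hφ.tendsto_atTop.comp hχ.tendsto_atTop
    refine ⟨fun k => wtMix (p (φ (χ k))) (t (φ (χ k))), fun k => t (φ (χ k)) 1,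
      fun k => t (φ (χ k)) 2, fun k => p (φ (χ k)) 2 * t (φ (χ k)) 2, fun k => - p (φ (χ k)) 2,
      fun k => ⟨wtMix_feasible (hA _), wtMix_PL (hA _), (hA _).2.2.1 1, (hA _).2.1 (by decide),
        (wtMix_last (hA _).2.1).1, (wtMix_last (hA _).2.1).2⟩, ?_, hχm.monotone,
      hesc.comp hsub, hφm.comp hχ.monotone, fun k => neg_nonpos.2 ((hA _).1 2), hflat.comp hsub⟩
    simp only [wtMix_obj a h hmeas M hM]
    exact hlim.comp hsub
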